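/- Let Γ : ℝ × J → ℝ³ be a smooth map such that each Γ(·,t) is a pseudo-arc parametrized null curve with curvature κ(s,t) and Frenet frame (t,n,b), and write ∂Γ/∂t = p₁ t + p₂ n + p₃ b. Let n ≥ 2 and let G₀, …, G_{n−1} : ℝ² → ℝ be smooth functions satisfying the Lenard recursion along κ: G₀ = 1/2 and ∂G_k/∂s = ∂³G_{k−1}/∂s³ + 4κ ∂G_{k−1}/∂s + 2(∂κ/∂s)G_{k−1} for k = 1,…,n−1. If p₃ = 4G_{n−2} and p₁ − ∂²p₃/∂s² − 2κp₃ = −2G_{n−1}, then the curvature evolves by the n-th equation of the KdV hierarchy: ∂κ/∂t = −(∂³G_{n−1}/∂s³ + 4κ ∂G_{n−1}/∂s + 2(∂κ/∂s)G_{n−1}). -/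

import Mathlib

noncomputable section

/-- The Minkowski bilinear form on `ℝ³`: `⟨x,y⟩ = -(x¹y³ + x³y¹) + x²y²`. -/
def mink (x y : Fin 3 → ℝ) : ℝ := -(x 0 * y 2 + x 2 * y 0) + x 1 * y 1

/-- Partial derivative in the first (space) variable, vector-valued. -/
def dsV (f : ℝ → ℝ → Fin 3 → ℝ) : ℝ → ℝ → Fin 3 → ℝ := fun s t => deriv (fun x => f x t) s

/-- Partial derivative in the second (time) variable, vector-valued. -/
def dtV (f : ℝ → ℝ → Fin 3 → ℝ) : ℝ → ℝ → Fin 3 → ℝ := fun s t => deriv (fun x => f s x) t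

/-- Partial derivative in the first (space) variable, scalar-valued. -/
def dsR (f : ℝ → ℝ → ℝ) : ℝ → ℝ → ℝ := fun s t => deriv (fun x => f x t) s

/-- Partial derivative in the second (time) variable, scalar-valued. -/
def dtR (f : ℝ → ℝ → ℝ) : ℝ → ℝ → ℝ := fun s t => deriv (fun x => f s x) t

def dsE {E : Type} [NormedAddCommGroup E] [NormedSpace ℝ E] (f : ℝ → ℝ → E) : ℝ → ℝ → E :=
  fun s t => deriv (fun x => f x t) s

def dtE {E : Type} [NormedAddCommGroup E] [NormedSpace ℝ E] (f : ℝ → ℝ → E) : ℝ → ℝ → E :=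
  fun s t => deriv (fun x => f s x) t

def Sm {E : Type} [NormedAddCommGroup E] [NormedSpace ℝ E] (J : Set ℝ) (f : ℝ → ℝ → E) : Prop :=
  ContDiffOn ℝ (⊤ : ℕ∞) (fun p : ℝ × ℝ => f p.1 p.2) (Set.univ ×ˢ J)

section gen
variable {E : Type} [NormedAddCommGroup E] [NormedSpace ℝ E] {J : Set ℝ} {f : ℝ → ℝ → E}

lemma Sm.cda (hJ : IsOpen J) (hf : Sm J f) (s : ℝ) {t : ℝ} (ht : t ∈ J) :
    ContDiffAt ℝ (⊤ : ℕ∞) (fun p : ℝ × ℝ => f p.1 p.2) (s, t) :=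
  hf.contDiffAt ((isOpen_univ.prod hJ).mem_nhds ⟨trivial, ht⟩)

lemma Sm.hfd (hJ : IsOpen J) (hf : Sm J f) (s : ℝ) {t : ℝ} (ht : t ∈ J) :
    HasFDerivAt (fun p : ℝ × ℝ => f p.1 p.2)
      (fderiv ℝ (fun p : ℝ × ℝ => f p.1 p.2) (s, t)) (s, t) :=
  ((hf.cda hJ s ht).differentiableAt (by simp)).hasFDerivAt

lemma Sm.hs' (hJ : IsOpen J) (hf : Sm J f) (s : ℝ) {t : ℝ} (ht : t ∈ J) :
    HasDerivAt (fun x => f x t) (fderiv ℝ (fun p : ℝ × ℝ => f p.1 p.2) (s, t) (1, 0)) s := by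
  have h1 : HasDerivAt (fun x : ℝ => (x, t)) ((1 : ℝ), (0 : ℝ)) s :=
    (hasDerivAt_id s).prodMk (hasDerivAt_const s t)
  exact (hf.hfd hJ s ht).comp_hasDerivAt s h1

lemma Sm.ht' (hJ : IsOpen J) (hf : Sm J f) (s : ℝ) {t : ℝ} (ht : t ∈ J) :
    HasDerivAt (fun x => f s x) (fderiv ℝ (fun p : ℝ × ℝ => f p.1 p.2) (s, t) (0, 1)) t := by
  have h1 : HasDerivAt (fun x : ℝ => (s, x)) ((0 : ℝ), (1 : ℝ)) t :=
    (hasDerivAt_const t s).prodMk (hasDerivAt_id t)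
  exact (hf.hfd hJ s ht).comp_hasDerivAt t h1

lemma Sm.hs (hJ : IsOpen J) (hf : Sm J f) (s : ℝ) {t : ℝ} (ht : t ∈ J) :
    HasDerivAt (fun x => f x t) (dsE f s t) s :=
  (hf.hs' hJ s ht).differentiableAt.hasDerivAt

lemma Sm.ht (hJ : IsOpen J) (hf : Sm J f) (s : ℝ) {t : ℝ} (ht : t ∈ J) :
    HasDerivAt (fun x => f s x) (dtE f s t) t :=
  (hf.ht' hJ s ht).differentiableAt.hasDerivAt

lemma Sm.fd (hJ : IsOpen J) (hf : Sm J f) :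
    ContDiffOn ℝ (⊤ : ℕ∞) (fderiv ℝ (fun p : ℝ × ℝ => f p.1 p.2)) (Set.univ ×ˢ J) :=
  ContDiffOn.fderiv_of_isOpen hf (isOpen_univ.prod hJ) (by simp)

lemma Sm.ds (hJ : IsOpen J) (hf : Sm J f) : Sm J (dsE f) := by
  refine ((hf.fd hJ).clm_apply (contDiffOn_const (c := ((1 : ℝ), (0 : ℝ))))).congr ?_
  rintro ⟨s, t⟩ ⟨-, ht⟩
  exact (hf.hs' hJ s ht).deriv

lemma Sm.dt (hJ : IsOpen J) (hf : Sm J f) : Sm J (dtE f) := by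
  refine ((hf.fd hJ).clm_apply (contDiffOn_const (c := ((0 : ℝ), (1 : ℝ))))).congr ?_
  rintro ⟨s, t⟩ ⟨-, ht⟩
  exact (hf.ht' hJ s ht).deriv

lemma app_deriv {L : ℝ → (ℝ × ℝ →L[ℝ] E)} {L' : ℝ × ℝ →L[ℝ] E} {x : ℝ}
    (h : HasDerivAt L L' x) (v : ℝ × ℝ) : HasDerivAt (fun y => L y v) (L' v) x :=
  (ContinuousLinearMap.apply ℝ E v).hasFDerivAt.comp_hasDerivAt x h

lemma app_comp {F : ℝ × ℝ → (ℝ × ℝ →L[ℝ] E)} {c : ℝ → ℝ × ℝ} {x : ℝ} {w : ℝ × ℝ}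
    {F' : ℝ × ℝ →L[ℝ] (ℝ × ℝ →L[ℝ] E)}
    (hF : HasFDerivAt F F' (c x)) (hc : HasDerivAt c w x) (v : ℝ × ℝ) :
    HasDerivAt (fun y => F (c y) v) (F' w v) x :=
  app_deriv (L := fun y => F (c y)) (hF.comp_hasDerivAt x hc) v

lemma Sm.comm (hJ : IsOpen J) (hf : Sm J f) (s : ℝ) {t : ℝ} (ht : t ∈ J) :
    dsE (dtE f) s t = dtE (dsE f) s t := by
  have hU : (Set.univ ×ˢ J : Set (ℝ × ℝ)) ∈ nhds (s, t) :=
    (isOpen_univ.prod hJ).mem_nhds ⟨trivial, ht⟩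
  set F := fderiv ℝ (fun p : ℝ × ℝ => f p.1 p.2) with hF
  have hFd : HasFDerivAt F (fderiv ℝ F (s, t)) (s, t) :=
    (((hf.fd hJ).contDiffAt hU).differentiableAt (by simp)).hasFDerivAt
  have h1 : HasDerivAt (fun x : ℝ => (x, t)) ((1 : ℝ), (0 : ℝ)) s :=
    (hasDerivAt_id s).prodMk (hasDerivAt_const s t)
  have h2 : HasDerivAt (fun x : ℝ => (s, x)) ((0 : ℝ), (1 : ℝ)) t :=
    (hasDerivAt_const t s).prodMk (hasDerivAt_id t)
  have a1 : HasDerivAt (fun x => F (x, t) (0, 1)) (fderiv ℝ F (s, t) (1, 0) (0, 1)) s := by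
    exact app_comp (c := fun x : ℝ => (x, t)) hFd h1 (0, 1)
  have a2 : HasDerivAt (fun x => F (s, x) (1, 0)) (fderiv ℝ F (s, t) (0, 1) (1, 0)) t := by
    exact app_comp (c := fun x : ℝ => (s, x)) hFd h2 (1, 0)
  have e1 : dsE (dtE f) s t = fderiv ℝ F (s, t) (1, 0) (0, 1) := by
    refine HasDerivAt.deriv (a1.congr_of_eventuallyEq ?_)
    exact Filter.Eventually.of_forall fun x => (hf.ht' hJ x ht).deriv
  have e2 : dtE (dsE f) s t = fderiv ℝ F (s, t) (0, 1) (1, 0) := by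
    refine HasDerivAt.deriv (a2.congr_of_eventuallyEq ?_)
    filter_upwards [hJ.mem_nhds ht] with x hx
    exact (hf.hs' hJ s hx).deriv
  rw [e1, e2]
  exact ((hf.cda hJ s ht).isSymmSndFDerivAt (by simp only [minSmoothness_of_isRCLikeNormedField]; exact WithTop.coe_le_coe.2 le_top)) _ _

end gen

lemma mink_deriv {f g : ℝ → Fin 3 → ℝ} {f' g' : Fin 3 → ℝ} {x : ℝ}
    (hf : HasDerivAt f f' x) (hg : HasDerivAt g g' x) :
    HasDerivAt (fun y => mink (f y) (g y)) (mink f' (g x) + mink (f x) g') x := by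
  have F := hasDerivAt_pi.1 hf
  have G := hasDerivAt_pi.1 hg
  have := ((((F 0).mul (G 2)).add ((F 2).mul (G 0))).neg).add ((F 1).mul (G 1))
  refine HasDerivAt.congr_deriv this ?_
  simp only [mink]; ring

lemma mink_const_deriv {f g : ℝ → Fin 3 → ℝ} {f' g' : Fin 3 → ℝ} {x c : ℝ}
    (hf : HasDerivAt f f' x) (hg : HasDerivAt g g' x)
    (h : ∀ᶠ y in nhds x, mink (f y) (g y) = c) : mink f' (g x) + mink (f x) g' = 0 :=
  (mink_deriv hf hg).unique ((hasDerivAt_const x c).congr_of_eventuallyEq h)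

lemma mink_symm (x y : Fin 3 → ℝ) : mink x y = mink y x := by simp only [mink]; ring
lemma mink_add (x y z : Fin 3 → ℝ) : mink (x + y) z = mink x z + mink y z := by
  simp only [mink, Pi.add_apply]; ring
lemma mink_smul (c : ℝ) (x z : Fin 3 → ℝ) : mink (c • x) z = c * mink x z := by
  simp only [mink, Pi.smul_apply, smul_eq_mul]; ring

lemma span0 (T N C v : Fin 3 → ℝ) (h1 : mink T T = 0) (h2 : mink T N = 0) (h3 : mink N N = 1)
    (h4 : mink T C = -1) (h5 : mink N C = 0)
    (a : mink v T = 0) (b : mink v N = 0) (c : mink v C = 0) : v = 0 := by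
  have hD : (T 0 * (N 1 * C 2 - N 2 * C 1) - T 1 * (N 0 * C 2 - N 2 * C 0)
      + T 2 * (N 0 * C 1 - N 1 * C 0)) ^ 2 = 1 := by
    have : (T 0 * (N 1 * C 2 - N 2 * C 1) - T 1 * (N 0 * C 2 - N 2 * C 0)
      + T 2 * (N 0 * C 1 - N 1 * C 0)) ^ 2 = -(mink T T * (mink N N * mink C C - mink N C ^ 2)
        - mink T N * (mink T N * mink C C - mink N C * mink T C)
        + mink T C * (mink T N * mink N C - mink N N * mink T C)) := by
      simp only [mink]; ring
    rw [this, h1, h2, h3, h4, h5]; ring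
  have hD0 : (T 0 * (N 1 * C 2 - N 2 * C 1) - T 1 * (N 0 * C 2 - N 2 * C 0)
      + T 2 * (N 0 * C 1 - N 1 * C 0)) ≠ 0 := by
    intro h; rw [h] at hD; norm_num at hD
  simp only [mink] at a b c
  ext i
  refine (mul_eq_zero.1 (?_ : (T 0 * (N 1 * C 2 - N 2 * C 1) - T 1 * (N 0 * C 2 - N 2 * C 0)
      + T 2 * (N 0 * C 1 - N 1 * C 0)) * v i = 0)).resolve_left hD0
  fin_cases i
  · show _ * v 0 = 0
    linear_combination -(N 0 * C 1 - N 1 * C 0) * a + (T 0 * C 1 - T 1 * C 0) * b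
      - (T 0 * N 1 - T 1 * N 0) * c
  · show _ * v 1 = 0
    linear_combination -(N 0 * C 2 - N 2 * C 0) * a + (T 0 * C 2 - T 2 * C 0) * b
      - (T 0 * N 2 - T 2 * N 0) * c
  · show _ * v 2 = 0
    linear_combination -(N 1 * C 2 - N 2 * C 1) * a + (T 1 * C 2 - T 2 * C 1) * b
      - (T 1 * N 2 - T 2 * N 1) * c

lemma core (T N C F W0 W1 W2 W3 : ℝ → Fin 3 → ℝ)
    (k k' p1 p1' p1'' p2 p2' p3 p3' p3'' b b' b'' b''' : ℝ → ℝ)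
    (hT : ∀ s, HasDerivAt T (N s) s) (hN : ∀ s, HasDerivAt N (C s) s)
    (hC : ∀ s, HasDerivAt C (F s) s)
    (hW0 : ∀ s, HasDerivAt W0 (W1 s) s) (hW1 : ∀ s, HasDerivAt W1 (W2 s) s)
    (hW2 : ∀ s, HasDerivAt W2 (W3 s) s)
    (hk : ∀ s, HasDerivAt k (k' s) s)
    (hp1 : ∀ s, HasDerivAt p1 (p1' s) s) (hp1' : ∀ s, HasDerivAt p1' (p1'' s) s)
    (hp2 : ∀ s, HasDerivAt p2 (p2' s) s)
    (hp3 : ∀ s, HasDerivAt p3 (p3' s) s) (hp3' : ∀ s, HasDerivAt p3' (p3'' s) s)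
    (hb : ∀ s, HasDerivAt b (b' s) s) (hb' : ∀ s, HasDerivAt b' (b'' s) s)
    (hb'' : ∀ s, HasDerivAt b'' (b''' s) s)
    (h1 : ∀ s, mink (T s) (T s) = 0) (h3 : ∀ s, mink (N s) (N s) = 1)
    (hkC : ∀ s, k s = (1/4) * mink (C s) (C s))
    (hW : ∀ s, W0 s = p1 s • T s + p2 s • N s + p3 s • (C s + (2 * k s) • T s))
    (hbb : ∀ s, p1 s - p3'' s - 2 * k s * p3 s = b s)
    (hWT : ∀ s, mink (W1 s) (T s) = 0) (hWN : ∀ s, mink (W2 s) (N s) = 0) (s : ℝ) :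
    mink (W3 s) (C s) = b''' s + 4 * k s * b' s + 2 * k' s * b s := by
  have h2 : ∀ s, mink (T s) (N s) = 0 := fun s => by
    have := mink_const_deriv (hT s) (hT s) (.of_forall h1)
    rw [mink_symm (N s)] at this; linarith
  have h5 : ∀ s, mink (N s) (C s) = 0 := fun s => by
    have := mink_const_deriv (hN s) (hN s) (.of_forall h3)
    rw [mink_symm (C s)] at this; linarith
  have h4 : ∀ s, mink (T s) (C s) = -1 := fun s => by
    have := mink_const_deriv (hT s) (hN s) (.of_forall h2)
    rw [h3] at this; linarith
  have h6 : ∀ s, mink (C s) (C s) = 4 * k s := fun s => by rw [hkC]; ring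
  have f1 : ∀ s, mink (F s) (T s) = 0 := fun s => by
    have := mink_const_deriv (hT s) (hC s) (.of_forall h4)
    rw [h5, mink_symm (T s)] at this; linarith
  have f2 : ∀ s, mink (F s) (N s) = -4 * k s := fun s => by
    have := mink_const_deriv (hN s) (hC s) (.of_forall h5)
    rw [h6, mink_symm (N s)] at this; linarith
  have f3 : ∀ s, mink (F s) (C s) = 2 * k' s := fun s => by
    have := (mink_deriv (hC s) (hC s)).unique
      (((hk s).const_mul 4).congr_of_eventuallyEq (.of_forall h6))
    rw [mink_symm (C s)] at this; linarith
  have h2' : ∀ s, mink (N s) (T s) = 0 := fun s => by rw [mink_symm, h2]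
  have h4' : ∀ s, mink (C s) (T s) = -1 := fun s => by rw [mink_symm, h4]
  have h5' : ∀ s, mink (C s) (N s) = 0 := fun s => by rw [mink_symm, h5]
  have hF : ∀ s, F s = (-2 * k' s) • T s + (-4 * k s) • N s := fun s => by
    have := span0 (T s) (N s) (C s) (F s + ((2 * k' s) • T s + (4 * k s) • N s))
      (h1 s) (h2 s) (h3 s) (h4 s) (h5 s)
      (by simp only [mink_add, mink_smul, h1, h2', f1]; ring)
      (by simp only [mink_add, mink_smul, h2, h3, f2]; ring)
      (by simp only [mink_add, mink_smul, h4, h5, f3]; ring)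
    rw [eq_neg_of_add_eq_zero_left this]; module
  have hW1e : ∀ s, W1 s = (p1' s - 2 * k s * p2 s) • T s + (p1 s + p2' s - 2 * k s * p3 s) • N s
      + (p3' s + p2 s) • (C s + (2 * k s) • T s) := fun s => by
    have := (((hp1 s).smul (hT s)).add ((hp2 s).smul (hN s))).add
      ((hp3 s).smul ((hC s).add (((hk s).const_mul 2).smul (hT s))))
    rw [(hW0 s).unique (this.congr_of_eventuallyEq (.of_forall hW))]
    rw [hF]; simp only [Pi.add_apply, Pi.smul_apply', Pi.mul_apply]; module
  have hp23 : ∀ s, p2 s = - p3' s := fun s => by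
    have := hWT s
    rw [hW1e] at this
    simp only [mink_add, mink_smul, h1, h2', h4'] at this; linarith
  have hp23' : ∀ s, p2' s = - p3'' s := fun s =>
    (hp2 s).unique ((hp3' s).neg.congr_of_eventuallyEq (.of_forall hp23))
  have hW1f : ∀ s, W1 s = (p1' s + 2 * k s * p3' s) • T s + b s • N s := fun s => by
    rw [hW1e, ← hbb, hp23, hp23']; module
  have ha : ∀ s, p1' s + 2 * k s * p3' s = - b' s := fun s => by
    have := ((((hp1' s).add (((hk s).const_mul 2).mul (hp3' s))).smul (hT s))).add
      ((hb s).smul (hN s))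
    have e := (hW1 s).unique (this.congr_of_eventuallyEq (.of_forall hW1f))
    have q := hWN s
    rw [e] at q
    simp only [Pi.add_apply, Pi.mul_apply, mink_add, mink_smul, h2, h3, h5'] at q
    linarith
  have hW1g : ∀ s, W1 s = (- b' s) • T s + b s • N s := fun s => by rw [hW1f, ha]
  have hW2g : ∀ s, W2 s = (- b'' s) • T s + b s • C s := fun s => by
    have := ((hb' s).neg.smul (hT s)).add ((hb s).smul (hN s))
    rw [(hW1 s).unique (this.congr_of_eventuallyEq (.of_forall hW1g))]
    simp only [Pi.neg_apply]; module
  have := ((hb'' s).neg.smul (hT s)).add ((hb s).smul (hC s))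
  rw [(hW2 s).unique (this.congr_of_eventuallyEq (.of_forall hW2g))]
  simp only [Pi.neg_apply, mink_add, mink_smul, h4, h5, h6, f3]; ring

/-- if the variation field of a motion of null curves is built from the Lenard
sequence (`p₃ = 4G_{n-2}` and `p₁ - ∂²p₃/∂s² - 2κp₃ = -2G_{n-1}`), then the curvature
evolves by the `n`-th equation of the KdV hierarchy,
`∂κ/∂t = -(∂³G_{n-1}/∂s³ + 4κ ∂G_{n-1}/∂s + 2κ_s G_{n-1})`. -/
theorem stmt9 (J : Set ℝ) (hJopen : IsOpen J) (hJconn : J.OrdConnected)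
    (Γ : ℝ → ℝ → Fin 3 → ℝ)
    (hΓ : ContDiffOn ℝ (⊤ : ℕ∞) (fun p : ℝ × ℝ => Γ p.1 p.2) (Set.univ ×ˢ J))
    (hnull : ∀ s : ℝ, ∀ t ∈ J, mink (dsV Γ s t) (dsV Γ s t) = 0)
    (hfut : ∀ s : ℝ, ∀ t ∈ J, mink (dsV Γ s t) ![1, 0, 1] < 0)
    (hpa : ∀ s : ℝ, ∀ t ∈ J, mink (dsV (dsV Γ) s t) (dsV (dsV Γ) s t) = 1)
    (κ : ℝ → ℝ → ℝ)
    (hκ : ∀ s t, κ s t = (1/4) * mink (dsV (dsV (dsV Γ)) s t) (dsV (dsV (dsV Γ)) s t))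
    (T N B : ℝ → ℝ → Fin 3 → ℝ)
    (hT : ∀ s t, T s t = dsV Γ s t)
    (hN : ∀ s t, N s t = dsV (dsV Γ) s t)
    (hB : ∀ s t, B s t = dsV (dsV (dsV Γ)) s t + (2 * κ s t) • dsV Γ s t)
    (p₁ p₂ p₃ : ℝ → ℝ → ℝ)
    (hp₁ : ContDiffOn ℝ (⊤ : ℕ∞) (fun p : ℝ × ℝ => p₁ p.1 p.2) (Set.univ ×ˢ J))
    (hp₂ : ContDiffOn ℝ (⊤ : ℕ∞) (fun p : ℝ × ℝ => p₂ p.1 p.2) (Set.univ ×ˢ J))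
    (hp₃ : ContDiffOn ℝ (⊤ : ℕ∞) (fun p : ℝ × ℝ => p₃ p.1 p.2) (Set.univ ×ˢ J))
    (hmotion : ∀ s : ℝ, ∀ t ∈ J,
      dtV Γ s t = p₁ s t • T s t + p₂ s t • N s t + p₃ s t • B s t)
    (n : ℕ) (hn : 2 ≤ n)
    (G : ℕ → ℝ → ℝ → ℝ)
    (hGsmooth : ∀ k ≤ n - 1, ContDiffOn ℝ (⊤ : ℕ∞) (fun p : ℝ × ℝ => G k p.1 p.2) (Set.univ ×ˢ J))
    (hG0 : ∀ s t, G 0 s t = 1/2)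
    (hLenard : ∀ k, 1 ≤ k → k ≤ n - 1 → ∀ s : ℝ, ∀ t ∈ J,
      dsR (G k) s t =
        dsR (dsR (dsR (G (k - 1)))) s t + 4 * κ s t * dsR (G (k - 1)) s t +
          2 * dsR κ s t * G (k - 1) s t)
    (hp₃G : ∀ s : ℝ, ∀ t ∈ J, p₃ s t = 4 * G (n - 2) s t)
    (hp₁G : ∀ s : ℝ, ∀ t ∈ J,
      p₁ s t - dsR (dsR p₃) s t - 2 * κ s t * p₃ s t = -2 * G (n - 1) s t) :
    ∀ s : ℝ, ∀ t ∈ J,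
      dtR κ s t =
        -(dsR (dsR (dsR (G (n - 1)))) s t + 4 * κ s t * dsR (G (n - 1)) s t +
          2 * dsR κ s t * G (n - 1) s t) := by
  have S0 : Sm J Γ := hΓ
  have S1 : Sm J (dsV Γ) := S0.ds hJopen
  have S2 : Sm J (dsV (dsV Γ)) := S1.ds hJopen
  have S3 : Sm J (dsV (dsV (dsV Γ))) := S2.ds hJopen
  have SW0 : Sm J (dtV Γ) := S0.dt hJopen
  have SW1 : Sm J (dtV (dsV Γ)) := S1.dt hJopen
  have SW2 : Sm J (dtV (dsV (dsV Γ))) := S2.dt hJopen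
  have P1 : Sm J p₁ := hp₁
  have P2 : Sm J p₂ := hp₂
  have P3 : Sm J p₃ := hp₃
  have hG : Sm J (G (n - 1)) := hGsmooth _ le_rfl
  have hG1 : Sm J (dsR (G (n - 1))) := hG.ds hJopen
  have hG2 : Sm J (dsR (dsR (G (n - 1)))) := hG1.ds hJopen
  have hκ' : κ = fun s t => (1/4) * mink (dsV (dsV (dsV Γ)) s t) (dsV (dsV (dsV Γ)) s t) :=
    funext fun s => funext fun t => hκ s t
  intro s t ht
  have hkd : ∀ s, HasDerivAt (fun x => κ x t) (dsR κ s t) s := fun s => by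
    have h := S3.hs hJopen s ht
    have h' := (mink_deriv h h).const_mul (1/4)
    have : DifferentiableAt ℝ (fun x => κ x t) s := by
      rw [hκ']; exact h'.differentiableAt
    exact this.hasDerivAt
  have hW1 : ∀ s, HasDerivAt (fun x => dtV Γ x t) (dtV (dsV Γ) s t) s := fun s => by
    have h := SW0.hs hJopen s ht
    rwa [show dsE (dtV Γ) s t = dtV (dsV Γ) s t from S0.comm hJopen s ht] at h
  have hW2 : ∀ s, HasDerivAt (fun x => dtV (dsV Γ) x t) (dtV (dsV (dsV Γ)) s t) s := fun s => by
    have h := SW1.hs hJopen s ht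
    rwa [show dsE (dtV (dsV Γ)) s t = dtV (dsV (dsV Γ)) s t from S1.comm hJopen s ht] at h
  have hW3 : ∀ s, HasDerivAt (fun x => dtV (dsV (dsV Γ)) x t) (dtV (dsV (dsV (dsV Γ))) s t) s :=
    fun s => by
    have h := SW2.hs hJopen s ht
    rwa [show dsE (dtV (dsV (dsV Γ))) s t = dtV (dsV (dsV (dsV Γ))) s t from
      S2.comm hJopen s ht] at h
  have hkt : dtR κ s t
      = (1/2) * mink (dtV (dsV (dsV (dsV Γ))) s t) (dsV (dsV (dsV Γ)) s t) := by
    have h := S3.ht hJopen s ht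
    have h' := ((mink_deriv h h).const_mul (1/4)).deriv
    rw [hκ']
    refine h'.trans ?_
    rw [mink_symm (dsV (dsV (dsV Γ)) s t)]
    change (1/4) * (mink (dtV (dsV (dsV (dsV Γ))) s t) (dsV (dsV (dsV Γ)) s t)
      + mink (dtV (dsV (dsV (dsV Γ))) s t) (dsV (dsV (dsV Γ)) s t)) = _
    ring
  have key := core (fun x => dsV Γ x t) (fun x => dsV (dsV Γ) x t)
    (fun x => dsV (dsV (dsV Γ)) x t) (fun x => dsV (dsV (dsV (dsV Γ))) x t)
    (fun x => dtV Γ x t) (fun x => dtV (dsV Γ) x t) (fun x => dtV (dsV (dsV Γ)) x t)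
    (fun x => dtV (dsV (dsV (dsV Γ))) x t)
    (fun x => κ x t) (fun x => dsR κ x t) (fun x => p₁ x t) (fun x => dsR p₁ x t)
    (fun x => dsR (dsR p₁) x t) (fun x => p₂ x t) (fun x => dsR p₂ x t)
    (fun x => p₃ x t) (fun x => dsR p₃ x t) (fun x => dsR (dsR p₃) x t)
    (fun x => -2 * G (n - 1) x t) (fun x => -2 * dsR (G (n - 1)) x t)
    (fun x => -2 * dsR (dsR (G (n - 1))) x t) (fun x => -2 * dsR (dsR (dsR (G (n - 1)))) x t)
    (fun s => S1.hs hJopen s ht) (fun s => S2.hs hJopen s ht) (fun s => S3.hs hJopen s ht)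
    hW1 hW2 hW3 hkd (fun s => P1.hs hJopen s ht) (fun s => (P1.ds hJopen).hs hJopen s ht)
    (fun s => P2.hs hJopen s ht)
    (fun s => P3.hs hJopen s ht) (fun s => (P3.ds hJopen).hs hJopen s ht)
    (fun s => (hG.hs hJopen s ht).const_mul (-2)) (fun s => (hG1.hs hJopen s ht).const_mul (-2))
    (fun s => (hG2.hs hJopen s ht).const_mul (-2))
    (fun s => hnull s t ht) (fun s => hpa s t ht) (fun s => hκ s t)
    (fun s => by
      have := hmotion s t ht
      rw [hT, hN, hB] at this
      exact this)
    (fun s => hp₁G s t ht)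
    (fun s => by
      have h := S1.ht hJopen s ht
      have := mink_const_deriv h h
        (by filter_upwards [hJopen.mem_nhds ht] with y hy using hnull s y hy)
      rw [mink_symm (dsV Γ s t)] at this
      change mink (dtE (dsV Γ) s t) (dsV Γ s t) = 0
      linarith)
    (fun s => by
      have h := S2.ht hJopen s ht
      have := mink_const_deriv h h
        (by filter_upwards [hJopen.mem_nhds ht] with y hy using hpa s y hy)
      rw [mink_symm (dsV (dsV Γ) s t)] at this
      change mink (dtE (dsV (dsV Γ)) s t) (dsV (dsV Γ) s t) = 0
      linarith) s
  rw [hkt, key]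
  ring
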